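/- For all integers k ≥ 3, the sequence (av_n(A_{k,k}))^{1/n} converges, as n → ∞, to (k-2)^2 + 1. -/

import Mathlib

/-- A permutation `p` of length `n` contains the pattern `q` of length `k` if there
are positions `i₁ < i₂ < ⋯ < i_k` whose entries are order-isomorphic to `q`. -/
def Contains {n k : ℕ} (p : Equiv.Perm (Fin n)) (q : Equiv.Perm (Fin k)) : Prop :=
  ∃ f : Fin k → Fin n, StrictMono f ∧ ∀ r s : Fin k, q r < q s ↔ p (f r) < p (f s)

/-- `p` avoids every pattern in the set `S` of patterns of length `k`. -/
def AvoidsSet {n k : ℕ} (p : Equiv.Perm (Fin n)) (S : Set (Equiv.Perm (Fin k))) : Prop :=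
  ∀ q ∈ S, ¬ Contains p q

/-- `A_k`: the set of patterns of length `k` whose first `k-1` entries are increasing. -/
def Ak (k : ℕ) : Set (Equiv.Perm (Fin k)) :=
  { q | ∀ r s : Fin k, (r : ℕ) < (s : ℕ) → (s : ℕ) < k - 1 → q r < q s }

/-- `A_{k,i}`: the set `A_k` with the pattern ending in `i` removed (entries of patterns
are thought of as `1`-indexed values `1,…,k`, so value `i` corresponds to `i-1 : Fin k`). -/
def Aki (k i : ℕ) : Set (Equiv.Perm (Fin k)) :=
  { q ∈ Ak k | ∀ j : Fin k, (j : ℕ) = k - 1 → (q j : ℕ) ≠ i - 1 }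

/-- The number of permutations of length `n` avoiding the set of patterns `S`. -/
noncomputable def avSet (n : ℕ) {k : ℕ} (S : Set (Equiv.Perm (Fin k))) : ℕ :=
  Nat.card { p : Equiv.Perm (Fin n) // AvoidsSet p S }

/-- The number of permutations of length `n` avoiding the single pattern `q`. -/
noncomputable def avPat (n : ℕ) {k : ℕ} (q : Equiv.Perm (Fin k)) : ℕ :=
  Nat.card { p : Equiv.Perm (Fin n) // ¬ Contains p q }

/-- The rank of the entry in position `j` of `p`: the length of the longest increasing
subsequence of `p` ending in `p j`. -/
noncomputable def rank {n : ℕ} (p : Equiv.Perm (Fin n)) (j : Fin n) : ℕ :=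
  sSup { m : ℕ | ∃ f : Fin m → Fin n, StrictMono f ∧ StrictMono (p ∘ f) ∧
    (∀ r, f r ≤ j) ∧ (∃ r, f r = j) }


/-- every increasing chain of length `d+1` is followed only by larger entries -/
def Cond {n : ℕ} (d : ℕ) (p : Equiv.Perm (Fin n)) : Prop :=
  ∀ f : Fin (d+1) → Fin n, StrictMono f → StrictMono (p ∘ f) →
    ∀ j, f (Fin.last d) < j → p (f (Fin.last d)) < p j

lemma exists_std {k n : ℕ} (g : Fin k → Fin n) (hg : Function.Injective g) :
    ∃ q : Equiv.Perm (Fin k), ∀ r s, q r < q s ↔ g r < g s := by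
  refine ⟨(Tuple.sort g).symm, fun r s => ?_⟩
  have hm : StrictMono (g ∘ Tuple.sort g) :=
    (Tuple.monotone_sort g).strictMono_of_injective (hg.comp (Tuple.sort g).injective)
  have := hm.lt_iff_lt (a := (Tuple.sort g).symm r) (b := (Tuple.sort g).symm s)
  simpa using this.symm

lemma avoids_iff {n d : ℕ} (p : Equiv.Perm (Fin n)) :
    AvoidsSet p (Aki (d+2) (d+2)) ↔ Cond d p := by
  constructor
  · intro h f hf hpf j hj
    by_contra hlt
    have hne : p j ≠ p (f (Fin.last d)) := fun e => by
      have := p.injective e; subst this; exact lt_irrefl _ hj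
    have hlt : p j < p (f (Fin.last d)) := lt_of_le_of_ne (not_lt.mp hlt) hne
    let F : Fin (d+2) → Fin n := Fin.snoc (α := fun _ => Fin n) f j
    have hF1 : ∀ i : Fin (d+1), F i.castSucc = f i := fun i => by simp [F]
    have hF2 : F (Fin.last (d+1)) = j := by simp [F]
    have hF : StrictMono F := by
      rw [Fin.strictMono_iff_lt_succ]
      intro i
      induction i using Fin.lastCases with
      | last => rw [hF1, Fin.succ_last, hF2]; exact hj
      | cast i => rw [hF1, ← Fin.castSucc_succ, hF1]; exact hf (Fin.castSucc_lt_succ)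
    obtain ⟨q, hq⟩ := exists_std (p ∘ F) (p.injective.comp hF.injective)
    refine h q ⟨?_, ?_⟩ ⟨F, hF, fun r s => hq r s⟩
    · intro r s hrs hs
      rw [hq]
      have e1 : F r = f ⟨r, by omega⟩ := hF1 ⟨r, by omega⟩
      have e2 : F s = f ⟨s, by omega⟩ := hF1 ⟨s, by omega⟩
      simp only [Function.comp, e1, e2]
      exact hpf hrs
    · intro i hi hqi
      have e1 : i = Fin.last (d+1) := Fin.ext (by simpa using hi)
      have : q i < q (Fin.castSucc (Fin.last d)) := by
        rw [hq, e1]; simp only [Function.comp, hF1, hF2]; exact hlt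
      have h3 := (q (Fin.castSucc (Fin.last d))).isLt
      have : (q i : ℕ) < q (Fin.castSucc (Fin.last d)) := this
      omega
  · rintro h q ⟨hq, hq2⟩ ⟨F, hF, hFq⟩
    have h1 := h (fun i => F i.castSucc) (fun a b hab => hF (by simpa using hab))
      (fun a b hab => by
        simp only [Function.comp]
        rw [← hFq]
        exact hq _ _ hab (by simp; omega)) (F (Fin.last _)) (hF (Fin.castSucc_lt_last _))
    have hlast : ∀ r, q r ≤ q (Fin.last (d+1)) := by
      intro r
      induction r using Fin.lastCases with
      | last => exact le_rfl
      | cast r =>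
        have h2 : q (Fin.castSucc r) ≤ q (Fin.castSucc (Fin.last d)) := by
          rcases eq_or_lt_of_le (Fin.le_last r) with e | e
          · rw [e]
          · exact (hq _ _ (by simpa [Fin.lt_def] using e) (by simp)).le
        exact h2.trans ((hFq _ _).mpr h1).le
    apply hq2 (Fin.last (d+1)) (by simp)
    have := hlast (q.symm (Fin.last (d+1)))
    simp only [Equiv.apply_symm_apply] at this
    have := le_antisymm this (Fin.le_last _)
    rw [← this]; simp

open Classical in
/-- chain of length `m+1` ending at `i` -/
def Ch {n : ℕ} (p : Equiv.Perm (Fin n)) : ℕ → Fin n → Prop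
  | 0, _ => True
  | m+1, i => ∃ j, j < i ∧ p j < p i ∧ Ch p m j

lemma Ch_mono {n : ℕ} (p : Equiv.Perm (Fin n)) (m : ℕ) (i : Fin n) (h : Ch p (m+1) i) :
    Ch p m i := by
  induction m generalizing i with
  | zero => trivial
  | succ m ih =>
    obtain ⟨j, h1, h2, h3⟩ := h
    exact ⟨j, h1, h2, ih _ h3⟩

lemma Ch_chain {n : ℕ} (p : Equiv.Perm (Fin n)) (m : ℕ) (i : Fin n) (h : Ch p m i) :
    ∃ f : Fin (m+1) → Fin n, StrictMono f ∧ StrictMono (p ∘ f) ∧ f (Fin.last m) = i := by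
  induction m generalizing i with
  | zero =>
    refine ⟨fun _ => i, ?_, ?_, rfl⟩ <;>
    · intro a b hab
      exact absurd hab (by omega)
  | succ m ih =>
    obtain ⟨j, h1, h2, h3⟩ := h
    obtain ⟨f, hf, hpf, hl⟩ := ih _ h3
    let F : Fin (m+2) → Fin n := Fin.snoc (α := fun _ => Fin n) f i
    have hF1 : ∀ i : Fin (m+1), F i.castSucc = f i := fun i => by simp [F]
    have hF2 : F (Fin.last (m+1)) = i := by simp [F]
    refine ⟨F, ?_, ?_, hF2⟩
    · rw [Fin.strictMono_iff_lt_succ]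
      intro i
      induction i using Fin.lastCases with
      | last => rw [hF1, Fin.succ_last, hF2, hl]; exact h1
      | cast i => rw [hF1, ← Fin.castSucc_succ, hF1]; exact hf (Fin.castSucc_lt_succ)
    · rw [Fin.strictMono_iff_lt_succ]
      intro i
      simp only [Function.comp]
      induction i using Fin.lastCases with
      | last => rw [hF1, Fin.succ_last, hF2, hl]; exact h2
      | cast i => rw [hF1, ← Fin.castSucc_succ, hF1]; exact hpf (Fin.castSucc_lt_succ)

open Classical in
/-- truncated rank colouring -/
noncomputable def col {n : ℕ} (d : ℕ) (p : Equiv.Perm (Fin n)) (i : Fin n) : Fin (d+1) :=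
  ⟨Nat.findGreatest (fun m => Ch p m i) d, Nat.lt_succ_of_le (Nat.findGreatest_le d)⟩

lemma col_ch {n : ℕ} (d : ℕ) (p : Equiv.Perm (Fin n)) (i : Fin n) : Ch p (col d p i) i := by
  classical
  exact Nat.findGreatest_spec (P := fun m => Ch p m i) (Nat.zero_le d) trivial

lemma col_ge {n : ℕ} (d : ℕ) (p : Equiv.Perm (Fin n)) (i : Fin n) (m : ℕ) (hm : m ≤ d)
    (h : Ch p m i) : m ≤ col d p i := by
  classical
  exact Nat.le_findGreatest (P := fun m => Ch p m i) hm h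

lemma col_low {n : ℕ} (d : ℕ) (p : Equiv.Perm (Fin n)) (i j : Fin n) (hij : i < j)
    (h : col d p i = col d p j) (hd : col d p i ≠ Fin.last d) : p j < p i := by
  by_contra hlt
  have hlt : p i < p j := lt_of_le_of_ne (not_lt.mp hlt) (fun e => hij.ne (p.injective e))
  have h1 : (col d p i : ℕ) < d := by
    rcases eq_or_lt_of_le (Fin.le_last (col d p i)) with e | e
    · exact absurd e hd
    · exact e
  have h2 : Ch p (col d p i + 1) j := ⟨i, hij, hlt, col_ch d p i⟩
  have := col_ge d p j _ h1 h2
  rw [h] at this; omega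

lemma col_high {n : ℕ} (d : ℕ) (p : Equiv.Perm (Fin n)) (hp : Cond d p) (i j : Fin n) (hij : i < j)
    (hd : col d p i = Fin.last d) : p i < p j ∧ col d p j = Fin.last d := by
  have h1 : Ch p d i := by have := col_ch d p i; rw [hd] at this; simpa using this
  obtain ⟨f, hf, hpf, hl⟩ := Ch_chain p d i h1
  have h2 : p i < p j := by
    have := hp f hf hpf j (by rw [hl]; exact hij)
    rwa [hl] at this
  refine ⟨h2, ?_⟩
  have h3 : Ch p d j := Ch_mono p d j ⟨i, hij, h2, h1⟩
  have := col_ge d p j d le_rfl h3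
  exact le_antisymm (Fin.le_last _) this

lemma perm_eq_one {n : ℕ} {α : Type*} (u : Fin n → α) (π : Equiv.Perm (Fin n))
    (h1 : ∀ i, u (π i) = u i) (h2 : ∀ i j, i < j → u i = u j → π i < π j) (i : Fin n) : π i = i := by
  induction i using WellFoundedLT.induction with
  | ind i ih =>
    rcases lt_trichotomy (π i) i with h | h | h
    · exact π.injective (ih _ h)
    · exact h
    · have h3 : u (π.symm i) = u i := by rw [← h1]; simp
      rcases lt_trichotomy (π.symm i) i with h' | h' | h'
      · have := ih _ h'
        simp only [Equiv.apply_symm_apply] at this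
        rw [← this] at h'; exact absurd h' (lt_irrefl _)
      · have := congrArg π h'
        simp only [Equiv.apply_symm_apply] at this
        exact this.symm
      · have := h2 _ _ h' h3.symm
        simp only [Equiv.apply_symm_apply] at this
        exact absurd (this.trans h) (lt_irrefl _)

lemma col_inj {n d : ℕ} (p p' : Equiv.Perm (Fin n)) (hp : Cond d p) (hp' : Cond d p')
    (hu : col d p = col d p') (hv : col d p ∘ p.symm = col d p' ∘ p'.symm) : p = p' := by
  have key : ∀ i, (p.trans p'.symm) i = i := by
    apply perm_eq_one (col d p)
    · intro i
      have := congrFun hv (p i)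
      simp only [Function.comp, Equiv.symm_apply_apply] at this
      rw [Equiv.trans_apply, hu, ← this, hu]
    · intro i j hij huij
      have hc : ∀ i, col d p (p'.symm (p i)) = col d p i := by
        intro i
        have := congrFun hv (p i)
        simp only [Function.comp, Equiv.symm_apply_apply] at this
        rw [this, hu]
      simp only [Equiv.trans_apply]
      set a := p'.symm (p i) with ha
      set b := p'.symm (p j) with hb
      have ha' : p' a = p i := by simp [ha]
      have hb' : p' b = p j := by simp [hb]
      have hab : a ≠ b := fun e => hij.ne (p.injective (by rw [← ha', ← hb', e]))
      by_contra hlt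
      have hlt : b < a := lt_of_le_of_ne (not_lt.mp hlt) hab.symm
      by_cases hd : col d p i = Fin.last d
      · have h1 := (col_high d p hp i j hij hd).1
        have h2 := (col_high d p' hp' b a hlt (by rw [← hu, hc, ← huij, hd])).1
        rw [ha', hb'] at h2
        exact absurd (h1.trans h2) (lt_irrefl _)
      · have h1 := col_low d p i j hij huij hd
        have h2 := col_low d p' b a hlt (by rw [← hu, hc, hc, huij]) (by rwa [← hu, hc, ← huij])
        rw [ha', hb'] at h2
        exact absurd (h1.trans h2) (lt_irrefl _)
  ext i
  have := key i
  rw [Equiv.trans_apply, Equiv.symm_apply_eq] at this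
  rw [this]

open Classical in
lemma upper (n d : ℕ) : Nat.card {p : Equiv.Perm (Fin n) // Cond d p} ≤ (d^2+1)^n := by
  let mm : (Fin n → Fin (d+1)) → ℕ := fun v => (Finset.univ.filter fun y => v y ≠ Fin.last d).card
  let R : (Fin n → Fin (d+1)) → Finset (Fin n → Fin (d+1)) := fun v =>
    Fintype.piFinset fun i => if (i : ℕ) < mm v then Finset.univ.erase (Fin.last d) else {Fin.last d}
  have hR : ∀ v, (R v).card ≤ d ^ mm v := by
    intro v
    simp only [R, Fintype.card_piFinset]
    have : ∀ i : Fin n, (if (i : ℕ) < mm v then Finset.univ.erase (Fin.last d) else {Fin.last d}).card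
        = if (i : ℕ) < mm v then d else 1 := by
      intro i; split_ifs <;> simp
    rw [Finset.prod_congr rfl (fun i _ => this i), Finset.prod_ite]
    simp only [Finset.prod_const, one_pow, mul_one]
    have hm : mm v ≤ n := (Finset.card_le_univ _).trans (by simp)
    have hc : (Finset.univ.filter fun i : Fin n => (i : ℕ) < mm v).card = mm v := by
      rw [Fin.card_filter_val_lt]; omega
    rw [hc]
  let T : Finset ((_ : Fin n → Fin (d+1)) × (Fin n → Fin (d+1))) := Finset.univ.sigma R
  have hT : T.card ≤ (d^2+1)^n := by
    rw [Finset.card_sigma]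
    calc _ ≤ ∑ v, d ^ mm v := Finset.sum_le_sum fun v _ => hR v
      _ = ∑ v : Fin n → Fin (d+1), ∏ y, (if v y ≠ Fin.last d then d else 1) := by
          apply Finset.sum_congr rfl; intro v _
          rw [Finset.prod_ite]; simp [mm]
      _ = ∏ y : Fin n, ∑ c : Fin (d+1), (if c ≠ Fin.last d then d else 1) := by
          rw [Finset.prod_univ_sum]; simp
      _ = (d^2+1)^n := by
          rw [Finset.prod_const, Fin.sum_univ_castSucc]
          simp [Fin.castSucc_ne_last, sq]
  let F : {p : Equiv.Perm (Fin n) // Cond d p} → T := fun p =>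
    ⟨⟨col d p.1 ∘ p.1.symm, col d p.1⟩, by
      simp only [T, R, Finset.mem_sigma, Finset.mem_univ, true_and, Fintype.mem_piFinset]
      obtain ⟨p, hp⟩ := p
      have hm : mm (col d p ∘ p.symm) = (Finset.univ.filter fun i => col d p i ≠ Fin.last d).card := by
        simp only [mm]
        apply Finset.card_equiv p.symm
        simp
      rw [hm]
      intro i
      by_cases h : col d p i = Fin.last d
      · have : (Finset.univ.filter fun i => col d p i ≠ Fin.last d) ⊆ Finset.Iio i := by
          intro j hj
          simp only [Finset.mem_filter, Finset.mem_univ, true_and] at hj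
          rw [Finset.mem_Iio]
          by_contra hij
          rcases eq_or_lt_of_le (not_lt.mp hij) with e | e
          · exact hj (e ▸ h)
          · exact hj (col_high d p hp i j e h).2
        have := Finset.card_le_card this
        rw [Fin.card_Iio] at this
        rw [if_neg (by omega)]
        simpa using h
      · have : Finset.Iic i ⊆ (Finset.univ.filter fun i => col d p i ≠ Fin.last d) := by
          intro j hj
          simp only [Finset.mem_filter, Finset.mem_univ, true_and]
          rw [Finset.mem_Iic] at hj
          intro hl
          rcases eq_or_lt_of_le hj with e | e
          · exact h (e ▸ hl)
          · exact h (col_high d p hp j i e hl).2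
        have := Finset.card_le_card this
        rw [Fin.card_Iic] at this
        rw [if_pos (by omega)]
        simpa using h⟩
  have hF : Function.Injective F := by
    intro p p' h
    have h := congrArg Subtype.val h
    simp only [F, Sigma.mk.injEq, heq_eq_eq] at h
    exact Subtype.ext (col_inj p.1 p'.1 p.2 p'.2 h.2 h.1)
  calc _ ≤ Nat.card T := Nat.card_le_card_of_injective F hF
    _ = T.card := by simp
    _ ≤ _ := hT

/-- `σ` is a union of `d` decreasing sequences -/
def DCol {m : ℕ} (d : ℕ) (σ : Equiv.Perm (Fin m)) : Prop :=
  ∃ u : Fin m → Fin d, ∀ i j, i < j → σ i < σ j → u i ≠ u j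

/-- glue a low prefix and an increasing suffix -/
def glue {m h : ℕ} (S : Finset (Fin (m+h))) (hS : S.card = m) (hS' : Sᶜ.card = h)
    (σ : Equiv.Perm (Fin m)) : Equiv.Perm (Fin (m+h)) :=
  finSumFinEquiv.symm.trans ((Equiv.sumCongr σ (Equiv.refl _)).trans (finSumEquivOfFinset hS hS'))

lemma glue_left {m h : ℕ} (S : Finset (Fin (m+h))) (hS : S.card = m) (hS' : Sᶜ.card = h)
    (σ : Equiv.Perm (Fin m)) (i : Fin m) :
    glue S hS hS' σ (Fin.castAdd h i) = S.orderEmbOfFin hS (σ i) := by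
  simp [glue]

lemma glue_right {m h : ℕ} (S : Finset (Fin (m+h))) (hS : S.card = m) (hS' : Sᶜ.card = h)
    (σ : Equiv.Perm (Fin m)) (i : Fin h) :
    glue S hS hS' σ (Fin.natAdd m i) = Sᶜ.orderEmbOfFin hS' i := by
  simp [glue]

lemma glue_cond {m h d : ℕ} (S : Finset (Fin (m+h))) (hS : S.card = m) (hS' : Sᶜ.card = h)
    (σ : Equiv.Perm (Fin m)) (hσ : DCol d σ) : Cond d (glue S hS hS' σ) := by
  intro f hf hpf j hj
  by_cases hl : (f (Fin.last d) : ℕ) < m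
  · exfalso
    obtain ⟨u, hu⟩ := hσ
    have hlt : ∀ r, (f r : ℕ) < m := fun r => lt_of_le_of_lt (hf.monotone (Fin.le_last r)) hl
    let g : Fin (d+1) → Fin m := fun r => ⟨f r, hlt r⟩
    have hg : ∀ r, f r = Fin.castAdd h (g r) := fun r => rfl
    obtain ⟨r, s, hrs, he⟩ := Fintype.exists_ne_map_eq_of_card_lt (fun r => u (g r)) (by simp)
    have aux : ∀ r s, r < s → u (g r) ≠ u (g s) := by
      intro r s hrs
      apply hu
      · exact hf hrs
      · have := hpf hrs
        simp only [Function.comp, hg, glue_left] at this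
        simpa using this
    rcases lt_or_gt_of_ne hrs with h1 | h1
    · exact aux _ _ h1 he
    · exact aux _ _ h1 he.symm
  · have hj' : (f (Fin.last d) : ℕ) < j := hj
    obtain ⟨a, ha⟩ : ∃ a : Fin h, f (Fin.last d) = Fin.natAdd m a :=
      ⟨⟨f (Fin.last d) - m, by omega⟩, Fin.ext (by simp; omega)⟩
    obtain ⟨b, hb⟩ : ∃ a : Fin h, j = Fin.natAdd m a :=
      ⟨⟨j - m, by omega⟩, Fin.ext (by simp; omega)⟩
    rw [ha, hb, glue_right, glue_right]
    rw [ha, hb] at hj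
    simpa using hj

lemma lowerC (m h d : ℕ) : (m+h).choose m * Nat.card {σ : Equiv.Perm (Fin m) // DCol d σ} ≤
    Nat.card {p : Equiv.Perm (Fin (m+h)) // Cond d p} := by
  have hc : Nat.card {S : Finset (Fin (m+h)) // S.card = m} = (m+h).choose m := by
    rw [Nat.card_eq_fintype_card, Fintype.card_finset_len]; simp
  rw [← hc, ← Nat.card_prod]
  have hS' : ∀ S : Finset (Fin (m+h)), S.card = m → Sᶜ.card = h := by
    intro S hS; rw [Finset.card_compl, hS]; simp
  let F : {S : Finset (Fin (m+h)) // S.card = m} × {σ : Equiv.Perm (Fin m) // DCol d σ} →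
      {p : Equiv.Perm (Fin (m+h)) // Cond d p} := fun x =>
    ⟨glue x.1.1 x.1.2 (hS' _ x.1.2) x.2.1, glue_cond _ _ _ _ x.2.2⟩
  apply Nat.card_le_card_of_injective F
  rintro ⟨⟨S, hS⟩, ⟨σ, hσ⟩⟩ ⟨⟨S', hS2⟩, ⟨σ', hσ'⟩⟩ hh
  have hh : glue S hS (hS' _ hS) σ = glue S' hS2 (hS' _ hS2) σ' := congrArg Subtype.val hh
  have key : ∀ i, S.orderEmbOfFin hS (σ i) = S'.orderEmbOfFin hS2 (σ' i) := by
    intro i; rw [← glue_left S hS (hS' _ hS), hh, glue_left]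
  have hSS : S = S' := by
    apply Finset.eq_of_subset_of_card_le _ (by omega)
    intro x hx
    have : x ∈ Set.range (S.orderEmbOfFin hS) := by simpa using hx
    obtain ⟨i, rfl⟩ := this
    have := key (σ.symm i)
    rw [Equiv.apply_symm_apply] at this
    rw [this]
    exact Finset.orderEmbOfFin_mem _ _ _
  subst hSS
  have : σ = σ' := by
    ext i
    have := key i
    simpa using congrArg Fin.val ((S.orderEmbOfFin hS).injective this)
  subst this
  rfl

lemma one_le_dcol (m e : ℕ) : 1 ≤ Nat.card {σ : Equiv.Perm (Fin m) // DCol (e+1) σ} := by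
  have : Nonempty {σ : Equiv.Perm (Fin m) // DCol (e+1) σ} :=
    ⟨Fin.revPerm, fun _ => 0, fun i j hij h => by simp at h; exact absurd (h.trans hij) (lt_irrefl _)⟩
  exact Nat.one_le_iff_ne_zero.mpr Nat.card_pos.ne'

lemma exists_perm {m : ℕ} {α : Type*} [DecidableEq α] (u v : Fin m → α)
    (h : ∀ c, (Finset.univ.filter fun i => u i = c).card = (Finset.univ.filter fun i => v i = c).card) :
    ∃ p : Equiv.Perm (Fin m), (∀ i, v (p i) = u i) ∧ ∀ i j, i < j → u i = u j → p j < p i := by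
  have eu : ∀ c, Fintype.card {i // u i = c} = Fintype.card {i // v i = c} := by
    intro c; rw [Fintype.card_subtype, Fintype.card_subtype, h]
  let e : ∀ c, {i // u i = c} ≃ {i // v i = c} := fun c =>
    (Fintype.orderIsoFinOfCardEq {i // u i = c} rfl).symm.toEquiv.trans
      (Fin.revPerm.trans (Fintype.orderIsoFinOfCardEq {i // v i = c} (eu c).symm).toEquiv)
  have he : ∀ c, ∀ a b, a < b → e c b < e c a := by
    intro c a b hab
    simp [e, hab]
  let p : Equiv.Perm (Fin m) := (Equiv.sigmaFiberEquiv u).symm.trans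
    ((Equiv.sigmaCongrRight e).trans (Equiv.sigmaFiberEquiv v))
  have hp : ∀ i c (hi : u i = c), p i = (e c ⟨i, hi⟩ : Fin m) := by
    rintro i c rfl; rfl
  refine ⟨p, fun i => ?_, fun i j hij huij => ?_⟩
  · rw [hp i _ rfl]; exact (e (u i) ⟨i, rfl⟩).2
  · rw [hp i _ huij, hp j _ rfl]
    exact he (u j) ⟨i, huij⟩ ⟨j, rfl⟩ hij

lemma core {m e : ℕ} (u v : Fin m → Fin (e+1)) (p : Equiv.Perm (Fin m)) (N : Fin (e+1) → ℕ) (B : ℕ)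
    (g : Fin e → ℕ) (hp1 : ∀ i, v (p i) = u i) (hp2 : ∀ i j, i < j → u i = u j → p j < p i)
    (hN : ∀ c, (Finset.univ.filter fun i => u i = c).card = N c)
    (hNg : ∀ c : Fin e, N c.castSucc = N c.succ + g c) (hg : ∀ c, 2 * B + 2 ≤ g c)
    (hu : ∀ i (c : Fin e), u i = c.succ → (Finset.univ.filter fun j => j < i ∧ u j = c.succ).card + g c
      ≤ (Finset.univ.filter fun j => j < i ∧ u j = c.castSucc).card + B)
    (hv : ∀ i (c : Fin e), v i = c.succ → (Finset.univ.filter fun j => j < i ∧ v j = c.succ).card + g c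
      ≤ (Finset.univ.filter fun j => j < i ∧ v j = c.castSucc).card + B)
    (i : Fin m) (c : Fin e) (hi : u i = c.succ) : ∃ j, j < i ∧ p j < p i ∧ u j = c.castSucc := by
  have tr : ∀ c, (Finset.univ.filter fun j => j < p i ∧ v j = c).card =
      (Finset.univ.filter fun j => p j < p i ∧ u j = c).card := by
    intro c
    symm
    apply Finset.card_equiv p
    intro j
    simp [hp1]
  have h1 := hu i c hi
  have h2 := hv (p i) c (by rw [hp1, hi])
  rw [tr, tr] at h2
  have h3 : (Finset.univ.filter fun j => j < i ∧ u j = c.succ).card + 1 +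
      (Finset.univ.filter fun j => p j < p i ∧ u j = c.succ).card = N c.succ := by
    rw [← hN c.succ]
    have : (Finset.univ.filter fun j => u j = c.succ) =
      ((Finset.univ.filter fun j => j < i ∧ u j = c.succ) ∪ {i}) ∪
        (Finset.univ.filter fun j => p j < p i ∧ u j = c.succ) := by
      ext j
      simp only [Finset.mem_filter, Finset.mem_univ, true_and, Finset.mem_union, Finset.mem_singleton]
      constructor
      · intro h
        rcases lt_trichotomy j i with h' | h' | h'
        · exact Or.inl (Or.inl ⟨h', h⟩)
        · exact Or.inl (Or.inr h')
        · exact Or.inr ⟨hp2 _ _ h' (by rw [hi, h]), h⟩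
      · rintro ((h | h) | h)
        · exact h.2
        · rw [h, hi]
        · exact h.2
    rw [this, Finset.card_union_of_disjoint, Finset.card_union_of_disjoint, Finset.card_singleton]
    · rw [Finset.disjoint_left]
      intro j hj hj'
      simp at hj hj'
      exact hj.1.ne hj'
    · rw [Finset.disjoint_left]
      intro j hj hj'
      simp only [Finset.mem_filter, Finset.mem_univ, true_and, Finset.mem_union, Finset.mem_singleton] at hj hj'
      rcases hj with hj | hj
      · exact absurd (hj'.1.trans (hp2 _ _ hj.1 (by rw [hi, hj.2]))) (lt_irrefl _)
      · rw [hj] at hj'; exact lt_irrefl _ hj'.1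
  by_contra hcon
  push Not at hcon
  have hd : Disjoint (Finset.univ.filter fun j => j < i ∧ u j = c.castSucc)
      (Finset.univ.filter fun j => p j < p i ∧ u j = c.castSucc) := by
    rw [Finset.disjoint_left]
    intro j hj hj'
    simp only [Finset.mem_filter, Finset.mem_univ, true_and] at hj hj'
    exact hcon j hj.1 hj'.1 hj.2
  have h4 := Finset.card_union_of_disjoint hd
  have h5 : ((Finset.univ.filter fun j => j < i ∧ u j = c.castSucc) ∪
      (Finset.univ.filter fun j => p j < p i ∧ u j = c.castSucc)).card ≤ N c.castSucc := by
    rw [← hN]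
    apply Finset.card_le_card
    intro j hj
    simp only [Finset.mem_filter, Finset.mem_univ, true_and, Finset.mem_union] at hj ⊢
    rcases hj with h | h <;> exact h.2
  have := hNg c
  have := hg c
  omega

lemma uniq {m : ℕ} (p : Equiv.Perm (Fin m)) (u u' : Fin m → ℕ)
    (a : ∀ i j, i < j → p i < p j → u i ≠ u j) (a' : ∀ i j, i < j → p i < p j → u' i ≠ u' j)
    (b : ∀ i c, u i = c + 1 → ∃ j, j < i ∧ p j < p i ∧ u j = c)
    (b' : ∀ i c, u' i = c + 1 → ∃ j, j < i ∧ p j < p i ∧ u' j = c) : u = u' := by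
  have desc : ∀ w : Fin m → ℕ, (∀ i c, w i = c + 1 → ∃ j, j < i ∧ p j < p i ∧ w j = c) →
      ∀ t i c, w i = c + t + 1 → ∃ j, j < i ∧ p j < p i ∧ w j = c := by
    intro w hw t
    induction t with
    | zero => intro i c h; exact hw i c h
    | succ t ih =>
      intro i c h
      obtain ⟨j, h1, h2, h3⟩ := hw i _ h
      obtain ⟨l, h4, h5, h6⟩ := ih j c h3
      exact ⟨l, h4.trans h1, h5.trans h2, h6⟩
  have desc' : ∀ w : Fin m → ℕ, (∀ i c, w i = c + 1 → ∃ j, j < i ∧ p j < p i ∧ w j = c) →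
      ∀ i c, c < w i → ∃ j, j < i ∧ p j < p i ∧ w j = c := by
    intro w hw i c h
    exact desc w hw (w i - c - 1) i c (by omega)
  have half : ∀ w w' : Fin m → ℕ, (∀ i j, i < j → p i < p j → w i ≠ w j) →
      (∀ i c, w i = c + 1 → ∃ j, j < i ∧ p j < p i ∧ w j = c) →
      (∀ i c, w' i = c + 1 → ∃ j, j < i ∧ p j < p i ∧ w' j = c) →
      ∀ c, (∀ c' < c, ∀ i, w i = c' ↔ w' i = c') → ∀ i, w i = c → w' i = c := by
    intro w w' ha hb hb' c ih i hi
    by_contra hne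
    rcases lt_or_gt_of_ne hne with h | h
    · have := (ih _ h i).mpr rfl; omega
    · obtain ⟨j, h1, h2, h3⟩ := desc' w' hb' i c h
      rcases lt_trichotomy (w j) c with h4 | h4 | h4
      · have := (ih _ h4 j).mp rfl; omega
      · exact ha j i h1 h2 (by omega)
      · obtain ⟨l, h5, h6, h7⟩ := desc' w hb j c h4
        exact ha l i (h5.trans h1) (h6.trans h2) (by omega)
  have main : ∀ c i, u i = c ↔ u' i = c := by
    intro c
    induction c using Nat.strong_induction_on with
    | _ c ih =>
      intro i
      exact ⟨half u u' a b b' c ih i, half u' u a' b' b c (fun c' h i => (ih c' h i).symm) i⟩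
  funext i
  exact ((main (u i) i).mp rfl).symm

/-- near-ballot words with prescribed gaps -/
def GoodL {e : ℕ} (B : ℕ) (g : Fin e → ℕ) (l : List (Fin (e+1))) : Prop :=
  (∀ c : Fin e, l.count c.castSucc = l.count c.succ + g c) ∧
  ∀ t (c : Fin e), (t ++ [c.succ]) <+: l → t.count c.succ + g c ≤ t.count c.castSucc + B

lemma count_take {m : ℕ} {α : Type*} [DecidableEq α] [Inhabited α] (l : List α) (hl : l.length = m)
    (c : α) (i : ℕ) (hi : i ≤ m) :
    (Finset.univ.filter fun j : Fin m => (j : ℕ) < i ∧ l.getD j default = c).card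
      = (l.take i).count c := by
  induction i with
  | zero => simp
  | succ i ih =>
    have hi' : i < l.length := by omega
    rw [List.take_add_one, List.getElem?_eq_getElem hi', List.count_append, ← ih (by omega)]
    have hh : l.getD i default = l[i] := by simp [List.getD, hi']
    by_cases h : l[i] = c
    · have : (Finset.univ.filter fun j : Fin m => (j : ℕ) < i + 1 ∧ l.getD j default = c) =
          insert (⟨i, by omega⟩ : Fin m)
            (Finset.univ.filter fun j : Fin m => (j : ℕ) < i ∧ l.getD j default = c) := by
        ext j
        simp only [Finset.mem_filter, Finset.mem_univ, true_and, Finset.mem_insert, Fin.ext_iff]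
        constructor
        · rintro ⟨h1, h2⟩
          by_cases h3 : (j : ℕ) = i
          · exact Or.inl h3
          · exact Or.inr ⟨by omega, h2⟩
        · rintro (h1 | h1)
          · exact ⟨by omega, by rw [h1, hh, h]⟩
          · exact ⟨by omega, h1.2⟩
      rw [this, Finset.card_insert_of_notMem (by simp)]
      simp [h]
    · have : (Finset.univ.filter fun j : Fin m => (j : ℕ) < i + 1 ∧ l.getD j default = c) =
            (Finset.univ.filter fun j : Fin m => (j : ℕ) < i ∧ l.getD j default = c) := by
        ext j
        simp only [Finset.mem_filter, Finset.mem_univ, true_and]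
        constructor
        · rintro ⟨h1, h2⟩
          by_cases h3 : (j : ℕ) = i
          · rw [h3, hh] at h2; exact absurd h2 h
          · exact ⟨by omega, h2⟩
        · rintro h1
          exact ⟨by omega, h1.2⟩
      rw [this]
      simp [h]

lemma goodL_fun {m e B : ℕ} (g : Fin e → ℕ) (l : List (Fin (e+1))) (hl : l.length = m)
    (h : GoodL B g l) (i : Fin m) (c : Fin e) (hi : l.getD i default = c.succ) :
    (Finset.univ.filter fun j : Fin m => j < i ∧ l.getD j default = c.succ).card + g c
      ≤ (Finset.univ.filter fun j : Fin m => j < i ∧ l.getD j default = c.castSucc).card + B := by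
  have h1 := count_take l hl c.succ i i.2.le
  have h2 := count_take l hl c.castSucc i i.2.le
  simp only [← Fin.lt_def] at h1 h2
  rw [h1, h2]
  apply h.2
  have hi' : (i : ℕ) < l.length := by omega
  have : l.take i ++ [c.succ] = l.take (i+1) := by
    rw [List.take_add_one, List.getElem?_eq_getElem hi', ← hi]
    simp [List.getD, hi']
  rw [this]
  exact List.take_prefix _ _

lemma dbound {m e B : ℕ} (g : Fin e → ℕ) (hg : ∀ c, 2 * B + 2 ≤ g c) (N : Fin (e+1) → ℕ)
    (W : Finset (List (Fin (e+1)))) (h1 : ∀ l ∈ W, l.length = m) (h2 : ∀ l ∈ W, ∀ c, l.count c = N c)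
    (h3 : ∀ l ∈ W, GoodL B g l) :
    W.card ^ 2 ≤ Nat.card {σ : Equiv.Perm (Fin m) // DCol (e+1) σ} := by
  have hN : ∀ l ∈ W, ∀ c,
      (Finset.univ.filter fun j : Fin m => l.getD j default = c).card = N c := by
    intro l hl c
    have := count_take l (h1 l hl) c m le_rfl
    rw [← h2 l hl c]
    rw [List.take_of_length_le (h1 l hl).le] at this
    simpa using this
  have ex : ∀ x : W × W, ∃ p : Equiv.Perm (Fin m),
      (∀ i, x.2.1.getD (p i : Fin m) default = x.1.1.getD (i : Fin m) default) ∧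
      ∀ i j, i < j → x.1.1.getD (i : Fin m) default = x.1.1.getD (j : Fin m) default → p j < p i := by
    rintro ⟨⟨l, hl⟩, ⟨l', hl'⟩⟩
    apply exists_perm (fun i : Fin m => l.getD i default) (fun i : Fin m => l'.getD i default)
    intro c
    rw [hN l hl, hN l' hl']
  choose F hF1 hF2 using ex
  have hA : ∀ x : W × W, ∀ i j, i < j → F x i < F x j →
      x.1.1.getD (i : Fin m) default ≠ x.1.1.getD (j : Fin m) default := by
    intro x i j hij hlt he
    exact absurd (hlt.trans (hF2 x i j hij he)) (lt_irrefl _)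
  let G : W × W → {σ : Equiv.Perm (Fin m) // DCol (e+1) σ} := fun x => ⟨F x, _, hA x⟩
  have hcard : W.card ^ 2 = Nat.card (W × W) := by rw [Nat.card_prod]; simp [sq]
  rw [hcard]
  apply Nat.card_le_card_of_injective G
  intro x y hxy
  have hxy : F x = F y := congrArg Subtype.val hxy
  have hB : ∀ x : W × W, ∀ i c, ((x.1.1.getD (i : Fin m) default : Fin (e+1)) : ℕ) = c + 1 →
      ∃ j, j < i ∧ F x j < F x i ∧ ((x.1.1.getD (j : Fin m) default : Fin (e+1)) : ℕ) = c := by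
    intro x i c hi
    have hc : c < e := by
      have := (x.1.1.getD (i : Fin m) default : Fin (e+1)).isLt; omega
    obtain ⟨j, hj1, hj2, hj3⟩ := core (fun i : Fin m => x.1.1.getD i default)
      (fun i : Fin m => x.2.1.getD i default) (F x) N B g (hF1 x) (hF2 x) (hN _ x.1.2)
      (fun c => by rw [← h2 _ x.1.2, ← h2 _ x.1.2]; exact (h3 _ x.1.2).1 c) hg
      (fun i c hc => goodL_fun g _ (h1 _ x.1.2) (h3 _ x.1.2) i c hc)
      (fun i c hc => goodL_fun g _ (h1 _ x.2.2) (h3 _ x.2.2) i c hc) i ⟨c, hc⟩ (Fin.ext hi)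
    exact ⟨j, hj1, hj2, by have := congrArg Fin.val hj3; simpa using this⟩
  have hu := uniq (F x) (fun i => ((x.1.1.getD (i : Fin m) default : Fin (e+1)) : ℕ))
    (fun i => ((y.1.1.getD (i : Fin m) default : Fin (e+1)) : ℕ))
    (fun i j h h' h'' => hA x i j h h' (Fin.ext h''))
    (fun i j h h' h'' => hA y i j h (by rw [← hxy]; exact h') (Fin.ext h''))
    (hB x) (by rw [hxy]; exact hB y)
  have hext : ∀ l l' : List (Fin (e+1)), l.length = m → l'.length = m →
      (∀ i : Fin m, l.getD i default = l'.getD i default) → l = l' := by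
    intro l l' hl hl' h
    apply List.ext_getElem (by omega)
    intro i hi hi'
    have := h ⟨i, by omega⟩
    simpa [List.getD, hi, hi'] using this
  have e1 : x.1 = y.1 := by
    apply Subtype.ext
    apply hext _ _ (h1 _ x.1.2) (h1 _ y.1.2)
    intro i
    exact Fin.ext (congrFun hu i)
  have e2 : x.2 = y.2 := by
    apply Subtype.ext
    apply hext _ _ (h1 _ x.2.2) (h1 _ y.2.2)
    intro i
    have a1 := hF1 x ((F x).symm i)
    have a2 := hF1 y ((F x).symm i)
    rw [← hxy] at a2
    simp only [Equiv.apply_symm_apply] at a1 a2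
    rw [a1, a2, e1]
  exact Prod.ext e1 e2

lemma app_card {α : Type*} [DecidableEq α] (A A' : Finset (List α)) (a : ℕ)
    (hA : ∀ l ∈ A, l.length = a) :
    (Finset.image₂ (· ++ ·) A A').card = A.card * A'.card := by
  rw [Finset.card_image₂_iff]
  rintro ⟨x, y⟩ hx ⟨x', y'⟩ hx' h
  simp only [Set.mem_prod, Finset.mem_coe] at hx hx'
  have := List.append_inj h (by rw [hA _ hx.1, hA _ hx'.1])
  exact Prod.ext this.1 this.2

lemma popular (e L : ℕ) : ∃ (S : Finset (List (Fin (e+1)))) (n : Fin (e+1) → ℕ),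
    (∀ l ∈ S, l.length = L) ∧ (∀ l ∈ S, ∀ c, l.count c = n c) ∧ ∑ c, n c = L ∧
    (e+1)^L ≤ S.card * (L+1)^(e+1) := by
  classical
  let U : Finset (List (Fin (e+1))) := (Finset.univ : Finset (Fin L → Fin (e+1))).image List.ofFn
  have hU : U.card = (e+1)^L := by
    rw [Finset.card_image_of_injective _ List.ofFn_injective]; simp
  have hUl : ∀ l ∈ U, l.length = L := by
    intro l hl
    obtain ⟨f, -, rfl⟩ := Finset.mem_image.mp hl
    simp
  let ct : List (Fin (e+1)) → Fin (e+1) → ℕ := fun l c => l.count c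
  let t : Finset (Fin (e+1) → ℕ) := Fintype.piFinset fun _ => Finset.range (L+1)
  have ht : t.card = (L+1)^(e+1) := by simp [t]
  have hmaps : ∀ l ∈ U, ct l ∈ t := by
    intro l hl
    simp only [t, Fintype.mem_piFinset, Finset.mem_range, ct]
    intro c
    have := List.count_le_length (a := c) (l := l)
    rw [hUl l hl] at this; omega
  have htne : t.Nonempty := Finset.card_pos.mp (by rw [ht]; positivity)
  obtain ⟨n, hn, hmax⟩ := Finset.exists_max_image t (fun n => (U.filter fun l => ct l = n).card) htne
  have hb := Finset.card_le_mul_card_image_of_maps_to hmaps _ hmax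
  rw [hU, ht] at hb
  refine ⟨U.filter fun l => ct l = n, n, fun l hl => hUl l (Finset.mem_filter.mp hl).1,
    fun l hl c => congrFun (Finset.mem_filter.mp hl).2 c, ?_, hb⟩
  have : (U.filter fun l => ct l = n).Nonempty := by
    rw [← Finset.card_pos]
    by_contra h0
    have h0 : (U.filter fun l => ct l = n).card = 0 := by omega
    rw [h0] at hb
    have : 0 < (e+1)^L := by positivity
    omega
  obtain ⟨l, hl⟩ := this
  have hl := Finset.mem_filter.mp hl
  rw [← hUl l hl.1, ← hl.2]
  have := Multiset.sum_count_eq_card (s := Finset.univ) (m := (l : Multiset (Fin (e+1)))) (by simp)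
  simpa [ct] using this

lemma blocks (e L : ℕ) (S : Finset (List (Fin (e+1)))) (n : Fin (e+1) → ℕ)
    (h1 : ∀ l ∈ S, l.length = L) (h2 : ∀ l ∈ S, ∀ c, l.count c = n c) (hn : ∑ c, n c = L) :
    ∃ T : Finset (List (Fin (e+1))), T.card = S.card ^ (e+1) ∧
      (∀ l ∈ T, l.length = (e+1) * L) ∧ (∀ l ∈ T, ∀ c, l.count c = L) := by
  have step : ∀ j : ℕ, ∃ T : Finset (List (Fin (e+1))), T.card = S.card ^ j ∧
      (∀ l ∈ T, l.length = j * L) ∧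
      (∀ l ∈ T, ∀ c, l.count c = ∑ i ∈ Finset.range j, n (c - Fin.ofNat (e+1) i)) := by
    intro j
    induction j with
    | zero => exact ⟨{[]}, by simp, by simp, by simp⟩
    | succ j ih =>
      obtain ⟨T, hT1, hT2, hT3⟩ := ih
      have hinj : Function.Injective (fun x : Fin (e+1) => x + Fin.ofNat (e+1) j) := add_left_injective _
      refine ⟨Finset.image₂ (· ++ ·) T (S.image (List.map (fun x => x + Fin.ofNat (e+1) j))), ?_, ?_, ?_⟩
      · rw [app_card _ _ _ hT2, hT1, Finset.card_image_of_injective _ (List.map_injective_iff.mpr hinj),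
          pow_succ]
      · intro l hl
        obtain ⟨a, ha, b, hb, rfl⟩ := Finset.mem_image₂.mp hl
        obtain ⟨b, hb', rfl⟩ := Finset.mem_image.mp hb
        simp [hT2 a ha, h1 b hb']; ring
      · intro l hl c
        obtain ⟨a, ha, b, hb, rfl⟩ := Finset.mem_image₂.mp hl
        obtain ⟨b, hb', rfl⟩ := Finset.mem_image.mp hb
        have := List.count_map_of_injective b _ hinj (c - Fin.ofNat (e+1) j)
        simp only [sub_add_cancel] at this
        rw [List.count_append, hT3 a ha, this, h2 b hb', Finset.sum_range_succ]
  obtain ⟨T, hT1, hT2, hT3⟩ := step (e+1)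
  refine ⟨T, hT1, hT2, fun l hl c => ?_⟩
  rw [hT3 l hl, Finset.sum_range, ← hn]
  simp only [Fin.ofNat_eq_cast, Fin.cast_val_eq_self]
  exact Equiv.sum_comp (Equiv.subLeft c) n

lemma goodL_append {e B : ℕ} (g : Fin e → ℕ) (l b : List (Fin (e+1))) (hl : GoodL B g l)
    (hb : ∀ c, b.count c = B) : GoodL B g (l ++ b) := by
  refine ⟨fun c => ?_, fun t c ht => ?_⟩
  · rw [List.count_append, List.count_append, hb, hb, hl.1]; ring
  · by_cases hlen : (t ++ [c.succ]).length ≤ l.length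
    · exact hl.2 t c (List.prefix_of_prefix_length_le ht (List.prefix_append _ _) hlen)
    · have h1 : t <+: l ++ b := (List.prefix_append _ _).trans ht
      have h2 : l <+: t := by
        apply List.prefix_of_prefix_length_le (List.prefix_append _ _) h1
        simp at hlen; omega
      obtain ⟨t', rfl⟩ := h2
      have h3 : t' <+: b := by simpa using h1
      have h4 := h3.sublist.count_le c.succ
      rw [hb] at h4
      rw [List.count_append, List.count_append, hl.1]
      omega

lemma pad (e K s : ℕ) : ∃ l : List (Fin (e+1)),
    l.length = (∑ c : Fin (e+1), (e - c) * K) + s ∧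
    ∀ B, GoodL B (fun c : Fin e => K + if (c : ℕ) = 0 then s else 0) l := by
  let f : Fin (e+1) → ℕ := fun c => (e - c) * K + if c = 0 then s else 0
  let M : Multiset (Fin (e+1)) := ∑ c, Multiset.replicate (f c) c
  let l := M.sort (· ≤ ·)
  have hc : ∀ c, l.count c = f c := by
    intro c
    rw [← Multiset.coe_count, Multiset.sort_eq]
    simp [M, Multiset.count_sum', Multiset.count_replicate]
  have hg : ∀ c : Fin e, l.count c.castSucc = l.count c.succ + (K + if (c : ℕ) = 0 then s else 0) := by
    intro c
    rw [hc, hc]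
    have h1 : (c.succ = 0) = False := by simp
    have h2 : (c.castSucc = 0) = ((c : ℕ) = 0) := by simp [Fin.ext_iff]
    simp only [f, h1, h2, if_false, Fin.val_castSucc, Fin.val_succ]
    have : e - c = (e - (c + 1)) + 1 := by omega
    rw [this]; ring
  refine ⟨l, ?_, fun B => ⟨hg, fun t c ht => ?_⟩⟩
  · rw [Multiset.length_sort]
    simp [M, f, Finset.sum_add_distrib]
  · obtain ⟨r, hr⟩ := ht
    have hs : l.Pairwise (· ≤ ·) := Multiset.pairwise_sort _ _
    rw [← hr, List.append_assoc, List.pairwise_append] at hs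
    have h0 : ([c.succ] ++ r).count c.castSucc = 0 := by
      rw [List.count_eq_zero]
      intro hm
      rcases List.mem_append.mp hm with hm | hm
      · simp [Fin.ext_iff] at hm
      · have := (List.pairwise_append.mp hs.2.1).2.2 c.succ (by simp) _ hm
        simp [Fin.le_def] at this
    have h1 := hg c
    rw [← hr, List.append_assoc, List.count_append, h0, List.count_append] at h1
    beta_reduce
    omega

lemma dlow (e L : ℕ) : ∃ q : ℕ, (e+1)^L ≤ q * (L+1)^(e+1) ∧ ∀ r s : ℕ,
    q ^ ((e+1) * r * 2) ≤ Nat.card {σ : Equiv.Perm (Fin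
      ((∑ c : Fin (e+1), (e - c) * (2 * L + 2)) + s + r * ((e+1) * L))) // DCol (e+1) σ} := by
  obtain ⟨S, n, hS1, hS2, hn, hS3⟩ := popular e L
  obtain ⟨T, hT1, hT2, hT3⟩ := blocks e L S n hS1 hS2 hn
  refine ⟨S.card, hS3, fun r s => ?_⟩
  obtain ⟨l0, hl0, hgood⟩ := pad e (2 * L + 2) s
  have step : ∀ r : ℕ, ∃ W : Finset (List (Fin (e+1))), W.card = T.card ^ r ∧
      (∀ l ∈ W, l.length = (∑ c : Fin (e+1), (e - c) * (2 * L + 2)) + s + r * ((e+1) * L)) ∧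
      (∀ l ∈ W, ∀ c, l.count c = l0.count c + r * L) ∧
      (∀ l ∈ W, GoodL L (fun c : Fin e => (2 * L + 2) + if (c : ℕ) = 0 then s else 0) l) := by
    intro r
    induction r with
    | zero => exact ⟨{l0}, by simp, by simp [hl0], by simp, by simpa using hgood L⟩
    | succ r ih =>
      obtain ⟨W, hW1, hW2, hW3, hW4⟩ := ih
      refine ⟨Finset.image₂ (· ++ ·) W T, ?_, ?_, ?_, ?_⟩
      · rw [app_card _ _ _ hW2, hW1, pow_succ]
      all_goals
        intro l hl
        obtain ⟨a, ha, b, hb, rfl⟩ := Finset.mem_image₂.mp hl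
      · rw [List.length_append, hW2 a ha, hT2 b hb]; ring
      · intro c
        rw [List.count_append, hW3 a ha, hT3 b hb]; ring
      · exact goodL_append _ _ _ (hW4 a ha) (hT3 b hb)
  obtain ⟨W, hW1, hW2, hW3, hW4⟩ := step r
  have := dbound _ (by intro c; omega) _ W hW2 hW3 hW4
  refine le_trans (le_of_eq ?_) this
  rw [hW1, hT1]
  ring

lemma exists_L (K : ℕ) (y : ℝ) (hy0 : 0 < y) (hy : y < 1) :
    ∃ L : ℕ, 1 ≤ L ∧ ((L : ℝ) + 1) ^ K * y ^ L ≤ 1 := by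
  have h := tendsto_pow_const_mul_const_pow_of_abs_lt_one K (r := y) (by rw [abs_of_pos hy0]; exact hy)
  have h2 := (h.eventually (gt_mem_nhds hy0)).and (Filter.eventually_ge_atTop 2)
  obtain ⟨N, h3, h4⟩ := h2.exists
  obtain ⟨L, rfl⟩ : ∃ L, N = L + 1 := ⟨N - 1, by omega⟩
  refine ⟨L, by omega, ?_⟩
  push_cast at h3
  rw [pow_succ, ← mul_assoc] at h3
  by_contra hcon
  push Not at hcon
  nlinarith

lemma alow (e : ℕ) (x : ℝ) (hx0 : 0 < x) (hx : x < ((e : ℝ) + 1) ^ 2) : ∃ c : ℝ, 0 < c ∧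
    ∀ m : ℕ, c * x ^ m ≤ (Nat.card {σ : Equiv.Perm (Fin m) // DCol (e+1) σ} : ℝ) := by
  have hone : ∀ m, (1 : ℝ) ≤ (Nat.card {σ : Equiv.Perm (Fin m) // DCol (e+1) σ} : ℝ) := fun m => by
    exact_mod_cast one_le_dcol m e
  by_cases hx1 : x ≤ 1
  · refine ⟨1, one_pos, fun m => ?_⟩
    rw [one_mul]
    exact (pow_le_one₀ hx0.le hx1).trans (hone m)
  push Not at hx1
  have hd : (0 : ℝ) < ((e : ℝ) + 1) ^ 2 := by positivity
  obtain ⟨L, hL1, hL⟩ := exists_L (2 * (e+1)) (x / ((e : ℝ) + 1) ^ 2) (by positivity)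
    (by rw [div_lt_one hd]; exact hx)
  obtain ⟨q, hq, hlow⟩ := dlow e L
  set P := ∑ c : Fin (e+1), (e - (c : ℕ)) * (2 * L + 2) with hP
  have hqx : x ^ L ≤ (q : ℝ) ^ 2 := by
    have hq' : ((e : ℝ) + 1) ^ L ≤ q * ((L : ℝ) + 1) ^ (e+1) := by exact_mod_cast hq
    have hq2 : (((e : ℝ) + 1) ^ L) ^ 2 ≤ (q * ((L : ℝ) + 1) ^ (e+1)) ^ 2 :=
      pow_le_pow_left₀ (by positivity) hq' 2
    rw [div_pow, ← mul_div_assoc, div_le_one (by positivity)] at hL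
    have e1 : (((e : ℝ) + 1) ^ L) ^ 2 = (((e : ℝ) + 1) ^ 2) ^ L := pow_right_comm _ _ _
    have e2 : (q * ((L : ℝ) + 1) ^ (e+1)) ^ 2 = (q : ℝ) ^ 2 * ((L : ℝ) + 1) ^ (2 * (e+1)) := by ring
    rw [e1, e2] at hq2
    have h3 : ((L : ℝ) + 1) ^ (2 * (e+1)) * x ^ L ≤ ((L : ℝ) + 1) ^ (2 * (e+1)) * (q : ℝ) ^ 2 := by
      calc _ ≤ _ := hL
        _ ≤ _ := hq2
        _ = _ := by ring
    exact le_of_mul_le_mul_left h3 (by positivity)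
  have hDpos : 0 < (e+1) * L := by positivity
  refine ⟨(x ^ (P + (e+1) * L))⁻¹, by positivity, fun m => ?_⟩
  rw [inv_mul_le_iff₀ (by positivity)]
  by_cases hm : m < P
  · calc x ^ m ≤ x ^ (P + (e+1) * L) := pow_le_pow_right₀ hx1.le (by omega)
      _ ≤ _ := le_mul_of_one_le_right (by positivity) (hone m)
  · set r := (m - P) / ((e+1) * L) with hr
    set s := (m - P) % ((e+1) * L) with hs
    have hs' : s < (e+1) * L := Nat.mod_lt _ hDpos
    have hdm : (e+1) * L * r + s = m - P := Nat.div_add_mod _ _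
    have hmm : m = P + s + r * ((e+1) * L) := by
      rw [mul_comm r]; omega
    have h1 := hlow r s
    rw [← hmm] at h1
    have h2 : (q : ℝ) ^ ((e+1) * r * 2) ≤ (Nat.card {σ : Equiv.Perm (Fin m) // DCol (e+1) σ} : ℝ) := by
      exact_mod_cast h1
    calc x ^ m ≤ x ^ (P + (e+1) * L + r * ((e+1) * L)) := pow_le_pow_right₀ hx1.le (by omega)
      _ = x ^ (P + (e+1) * L) * (x ^ L) ^ ((e+1) * r) := by
          rw [pow_add, ← pow_mul]; congr 2; ring
      _ ≤ x ^ (P + (e+1) * L) * ((q : ℝ) ^ 2) ^ ((e+1) * r) := by gcongr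
      _ = x ^ (P + (e+1) * L) * (q : ℝ) ^ ((e+1) * r * 2) := by
          rw [← pow_mul (q : ℝ)]; congr 2; ring
      _ ≤ _ := by gcongr

lemma lowfinal (e : ℕ) (x : ℝ) (hx0 : 0 < x) (hx : x < ((e : ℝ) + 1) ^ 2) : ∃ c : ℝ, 0 < c ∧
    ∀ n : ℕ, c * (x + 1) ^ n ≤
      ((n : ℝ) + 1) * (Nat.card {p : Equiv.Perm (Fin n) // Cond (e+1) p} : ℝ) := by
  obtain ⟨c, hc, h⟩ := alow e x hx0 hx
  refine ⟨c, hc, fun n => ?_⟩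
  rw [add_pow, Finset.mul_sum]
  calc _ ≤ ∑ m ∈ Finset.range (n+1),
        (Nat.card {p : Equiv.Perm (Fin n) // Cond (e+1) p} : ℝ) := by
        apply Finset.sum_le_sum
        intro m hm
        obtain ⟨k, rfl⟩ : ∃ k, n = m + k := ⟨n - m, by have := Finset.mem_range.mp hm; omega⟩
        have h1 := lowerC m k (e+1)
        have h1 : ((m+k).choose m : ℝ) * (Nat.card {σ : Equiv.Perm (Fin m) // DCol (e+1) σ} : ℝ) ≤
          (Nat.card {p : Equiv.Perm (Fin (m+k)) // Cond (e+1) p} : ℝ) := by exact_mod_cast h1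
        refine le_trans ?_ h1
        calc c * (x ^ m * 1 ^ (m + k - m) * ((m+k).choose m : ℝ))
            = ((m+k).choose m : ℝ) * (c * x ^ m) := by rw [one_pow]; ring
          _ ≤ _ := mul_le_mul_of_nonneg_left (h m) (by positivity)
    _ = _ := by simp

/-- `(av_n(A_{k,k}))^{1/n} → (k-2)² + 1`. -/
theorem stmt7 (k : ℕ) (hk : 3 ≤ k) :
    Filter.Tendsto (fun n : ℕ => (avSet n (Aki k k) : ℝ) ^ (1 / (n : ℝ)))
      Filter.atTop (nhds (((k : ℝ) - 2) ^ 2 + 1)) := by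
  obtain ⟨e, rfl⟩ : ∃ e, k = (e + 1) + 2 := ⟨k - 3, by omega⟩
  have hav : ∀ n, avSet n (Aki (e+1+2) (e+1+2)) =
      Nat.card {p : Equiv.Perm (Fin n) // Cond (e+1) p} := by
    intro n
    exact Nat.card_congr (Equiv.subtypeEquivRight fun p => avoids_iff p)
  simp only [hav]
  have hlim : (((e + 1 + 2 : ℕ) : ℝ) - 2) ^ 2 + 1 = ((e : ℝ) + 1) ^ 2 + 1 := by push_cast; ring
  rw [hlim, tendsto_order]
  constructor
  · intro a ha
    obtain ⟨x, hx1, hx2⟩ := exists_between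
      (show max (a - 1) 0 < ((e : ℝ) + 1) ^ 2 from max_lt (by linarith) (by positivity))
    have hx0 : 0 < x := lt_of_le_of_lt (le_max_right _ _) hx1
    have hxa : a < x + 1 := by have := lt_of_le_of_lt (le_max_left _ _) hx1; linarith
    obtain ⟨b, hb1, hb2⟩ := exists_between (show max a 0 < x + 1 from max_lt hxa (by linarith))
    have hb0 : 0 < b := lt_of_le_of_lt (le_max_right _ _) hb1
    have hba : a < b := lt_of_le_of_lt (le_max_left _ _) hb1
    obtain ⟨c, hc, hlow⟩ := lowfinal e x hx0 hx2
    have hx10 : 0 < x + 1 := by linarith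
    have hr : b / (x + 1) < 1 := by rw [div_lt_one hx10]; exact hb2
    have hr0 : 0 < b / (x + 1) := by positivity
    have t1 := tendsto_pow_const_mul_const_pow_of_abs_lt_one 1 (r := b / (x + 1))
      (by rw [abs_of_pos hr0]; exact hr)
    have t2 := tendsto_pow_const_mul_const_pow_of_abs_lt_one 0 (r := b / (x + 1))
      (by rw [abs_of_pos hr0]; exact hr)
    have t3 := t1.add t2
    rw [add_zero] at t3
    filter_upwards [t3.eventually (gt_mem_nhds hc), Filter.eventually_ge_atTop 1] with n hn hn1
    have hbn : b ^ n ≤ (Nat.card {p : Equiv.Perm (Fin n) // Cond (e+1) p} : ℝ) := by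
      have h1 := hlow n
      have h2 : ((n : ℝ) + 1) * (b / (x + 1)) ^ n < c := by
        calc _ = _ := by ring
          _ < c := hn
      rw [div_pow, ← mul_div_assoc, div_lt_iff₀ (by positivity)] at h2
      exact le_of_mul_le_mul_left (h2.le.trans h1) (by positivity)
    calc a < b := hba
      _ = (b ^ n) ^ (1 / (n : ℝ)) := by
          rw [one_div, Real.pow_rpow_inv_natCast hb0.le (by omega)]
      _ ≤ _ := Real.rpow_le_rpow (by positivity) hbn (by positivity)
  · intro a ha
    filter_upwards [Filter.eventually_ge_atTop 1] with n hn1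
    refine lt_of_le_of_lt ?_ ha
    have h1 : (Nat.card {p : Equiv.Perm (Fin n) // Cond (e+1) p} : ℝ) ≤
        (((e : ℝ) + 1) ^ 2 + 1) ^ n := by exact_mod_cast upper n (e+1)
    calc _ ≤ ((((e : ℝ) + 1) ^ 2 + 1) ^ n) ^ (1 / (n : ℝ)) :=
          Real.rpow_le_rpow (by positivity) h1 (by positivity)
      _ = _ := by rw [one_div, Real.pow_rpow_inv_natCast (by positivity) (by omega)]
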